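/- For every n ≥ 1, k ≥ 2 and r ≥ 1, the commutator subgroup D(nV_{k,r}) of the higher dimensional Thompson group nV_{k,r} is a simple group. -/

import Mathlib

namespace NV

/-- The Cantor space `C_k = {0,…,k-1}^ℕ` of one-sided infinite sequences. -/
abbrev Cantor (k : ℕ) : Type := ℕ → Fin k

/-- Concatenation `u·x` of a finite word `u` with an infinite sequence `x`. -/
def concat {k : ℕ} (u : List (Fin k)) (x : Cantor k) : Cantor k :=
  fun i => if h : i < u.length then u.get ⟨i, h⟩ else x (i - u.length)

/-- The space `Y(n,k,r) = (C_k)^n × {1,…,r}`. -/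
abbrev Y (n k r : ℕ) : Type := (Fin n → Cantor k) × Fin r

/-- The box `{(u_1·x_1,…,u_n·x_n, a) : x_1,…,x_n ∈ C_k}` determined by
finite words `u_1,…,u_n` and an index `a`. -/
def box {n k r : ℕ} (u : Fin n → List (Fin k)) (a : Fin r) : Set (Y n k r) :=
  {y | ∃ x : Fin n → Cantor k, y = (fun i => concat (u i) (x i), a)}

/-- A permutation of `Y(n,k,r)` is an element of the higher dimensional Thompson
group `nV_{k,r}` if there are finitely many tuples of words and indices whose domain
boxes partition `Y(n,k,r)`, whose range boxes partition `Y(n,k,r)`, and on which `γ`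
acts by the corresponding prefix substitutions. -/
def IsElement {n k r : ℕ} (γ : Equiv.Perm (Y n k r)) : Prop :=
  ∃ (m : ℕ) (u v : Fin m → Fin n → List (Fin k)) (a b : Fin m → Fin r),
    (∀ y : Y n k r, ∃! t : Fin m, y ∈ box (u t) (a t)) ∧
    (∀ y : Y n k r, ∃! t : Fin m, y ∈ box (v t) (b t)) ∧
    (∀ (t : Fin m) (x : Fin n → Cantor k),
      γ (fun i => concat (u t i) (x i), a t) = (fun i => concat (v t i) (x i), b t))

/-- The underlying set of the higher dimensional Thompson group `nV_{k,r}`,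
as a set of permutations of `Y(n,k,r)`. -/
def thompsonSet (n k r : ℕ) : Set (Equiv.Perm (Y n k r)) := {γ | IsElement γ}

end NV

section Compressing

open scoped commutatorElement

variable {Γ X : Type*} [Group Γ] [MulAction Γ X]

/-- A family of subsets of `X` is *compressing* for an action of `Γ` if it satisfies the conditions
below, which make the commutator subgroup of a faithful action simple. -/
structure IsCompressing (Γ : Type*) {X : Type*} [Group Γ] [MulAction Γ X]
    (𝓑 : Set (Set X)) : Prop where
  nonempty : 𝓑.Nonempty
  nonempty_of_mem : ∀ B ∈ 𝓑, B.Nonempty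
  smul_mem : ∀ (g : Γ), ∀ B ∈ 𝓑, ∃ B' ∈ 𝓑, ∀ x ∈ B', g⁻¹ • x ∈ B
  split : ∀ A ∈ 𝓑, ∀ B ∈ 𝓑, ∃ A' ∈ 𝓑, ∃ B' ∈ 𝓑, A' ⊆ A ∧ B' ⊆ B ∧ Disjoint A' B'
  swap : ∀ C ∈ 𝓑, ∀ C' ∈ 𝓑, C' ⊆ C → ∃ s : Γ, s * s = 1 ∧ (∀ x ∉ C, s • x ∈ C') ∧
    ∀ x ∈ C, s • x ∈ C → s • x = x
  displace : ∀ g : Γ, g ≠ 1 → ∃ B ∈ 𝓑, ∀ x ∈ B, g • x ∉ B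
  factor : ∀ g : Γ, ∃ a b : Γ, g = a * b ∧ (∃ B ∈ 𝓑, ∀ x ∈ B, a • x = x) ∧
    ∃ B ∈ 𝓑, ∀ x ∈ B, b • x = x

theorem commute_of_supported [FaithfulSMul Γ X] {A B : Set X} (hAB : Disjoint A B) {g h : Γ}
    (hg : ∀ x ∉ A, g • x = x) (hh : ∀ x ∉ B, h • x = x) : Commute g h := by
  have key : ∀ {A B : Set X}, Disjoint A B → ∀ {g h : Γ}, (∀ x ∉ A, g • x = x) →
      (∀ x ∉ B, h • x = x) → ∀ x ∈ A, g • h • x = h • g • x := by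
    intro A B hAB g h hg hh x hx
    have hgx : g • x ∈ A := by
      by_contra hn
      have h1 := hg _ hn
      have h2 : g • x = x := smul_left_cancel g h1
      exact hn (h2.symm ▸ hx)
    rw [hh x (Set.disjoint_left.1 hAB hx), hh _ (Set.disjoint_left.1 hAB hgx)]
  refine FaithfulSMul.eq_of_smul_eq_smul (α := X) fun x => ?_
  rw [mul_smul, mul_smul]
  by_cases hA : x ∈ A
  · exact key hAB hg hh x hA
  by_cases hB : x ∈ B
  · exact (key hAB.symm hh hg x hB).symm
  · rw [hh x hB, hg x hA, hh x hB]

theorem smul_conj_eq_of_supported {A : Set X} {B : Set X} {g d : Γ}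
    (hg : ∀ x ∉ A, g • x = x) (hd : ∀ x ∈ A, d • x ∈ B) :
    ∀ x ∉ B, (d * g * d⁻¹) • x = x := by
  intro x hx
  have : d⁻¹ • x ∉ A := fun h => hx (by simpa using hd _ h)
  rw [mul_smul, mul_smul, hg _ this, smul_inv_smul]

theorem smul_mul_eq_of_supported {A : Set X} {g h : Γ}
    (hg : ∀ x ∉ A, g • x = x) (hh : ∀ x ∉ A, h • x = x) :
    ∀ x ∉ A, (g * h) • x = x := by
  intro x hx
  rw [mul_smul, hh x hx, hg x hx]

theorem smul_inv_eq_of_supported {A : Set X} {g : Γ}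
    (hg : ∀ x ∉ A, g • x = x) : ∀ x ∉ A, g⁻¹ • x = x := by
  intro x hx
  rw [inv_smul_eq_iff, hg x hx]

theorem commutatorElement_mul_left_of_commute {g k h : Γ} (hkh : Commute k h) :
    ⁅g * k, h⁆ = ⁅g, h⁆ := by
  have h1 : k * h * k⁻¹ = h := by rw [hkh.eq, mul_inv_cancel_right]
  calc ⁅g * k, h⁆ = g * (k * h * k⁻¹) * g⁻¹ * h⁻¹ := by
        simp only [commutatorElement_def]; group
    _ = ⁅g, h⁆ := by rw [h1, commutatorElement_def]

theorem commutatorElement_mul_right_of_commute {g k h : Γ} (hgk : Commute g k) :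
    ⁅g, h * k⁆ = ⁅g, h⁆ := by
  rw [← inv_inj, commutatorElement_inv, commutatorElement_inv,
    commutatorElement_mul_left_of_commute hgk.symm]

/-- The commutators of pairs of elements fixing a common member of `𝓑` pointwise. -/
def localCommutators (Γ : Type*) {X : Type*} [Group Γ] [MulAction Γ X]
    (𝓑 : Set (Set X)) : Set Γ :=
  {c | ∃ B ∈ 𝓑, ∃ g h : Γ, (∀ x ∈ B, g • x = x) ∧ (∀ x ∈ B, h • x = x) ∧ c = ⁅g, h⁆}

namespace IsCompressing

variable {𝓑 : Set (Set X)}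

theorem exists_three (H : IsCompressing Γ 𝓑) {B : Set X} (hB : B ∈ 𝓑) :
    ∃ A₁ ∈ 𝓑, ∃ A₂ ∈ 𝓑, ∃ A₃ ∈ 𝓑, A₁ ⊆ B ∧ A₂ ⊆ B ∧ A₃ ⊆ B ∧
      Disjoint A₁ A₂ ∧ Disjoint A₁ A₃ ∧ Disjoint A₂ A₃ := by
  obtain ⟨A, hA, A', hA', hAB, hAB', hd⟩ := H.split B hB B hB
  obtain ⟨C, hC, C', hC', hCA, hCA', hd'⟩ := H.split A' hA' A' hA'
  exact ⟨A, hA, C, hC, C', hC', hAB, hCA.trans hAB', hCA'.trans hAB',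
    hd.mono_right hCA, hd.mono_right hCA', hd'⟩

theorem exists_localCommutator_maps_compl (H : IsCompressing Γ 𝓑) {A B : Set X}
    (hA : A ∈ 𝓑) (hB : B ∈ 𝓑) (hAB : A ⊆ B) :
    ∃ d ∈ localCommutators Γ 𝓑, ∀ x ∉ B, d • x ∈ A := by
  obtain ⟨A₁, h₁, A₂, h₂, A₃, h₃, hA₁, hA₂, hA₃, h₁₂, h₁₃, h₂₃⟩ := H.exists_three hA
  obtain ⟨s, hs, hsB, hsf⟩ := H.swap B hB A₁ h₁ (hA₁.trans hAB)
  obtain ⟨t, ht, htB, htf⟩ := H.swap B hB A₂ h₂ (hA₂.trans hAB)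
  have hs' : ∀ x : X, s • s • x = x := fun x => by rw [← mul_smul, hs, one_smul]
  have ht' : ∀ x : X, t • t • x = x := fun x => by rw [← mul_smul, ht, one_smul]
  have fix_s : ∀ x ∈ B, x ∉ A₁ → s • x = x := fun x hx hx₁ => hsf x hx (by
    by_contra hn
    exact hx₁ (hs' x ▸ hsB _ hn))
  have fix_t : ∀ x ∈ B, x ∉ A₂ → t • x = x := fun x hx hx₁ => htf x hx (by
    by_contra hn
    exact hx₁ (ht' x ▸ htB _ hn))
  refine ⟨⁅s, t⁆, ⟨A₃, h₃, s, t,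
    fun x hx => fix_s x (hAB (hA₃ hx)) (Set.disjoint_right.1 h₁₃ hx),
    fun x hx => fix_t x (hAB (hA₃ hx)) (Set.disjoint_right.1 h₂₃ hx), rfl⟩, fun x hx => ?_⟩
  have hsi : s⁻¹ = s := inv_eq_of_mul_eq_one_left hs
  have hti : t⁻¹ = t := inv_eq_of_mul_eq_one_left ht
  rw [commutatorElement_def, hsi, hti, mul_smul, mul_smul, mul_smul,
    fix_s (t • x) (hAB (hA₂ (htB x hx))) (Set.disjoint_right.1 h₁₂ (htB x hx)), ht']
  exact hA₁ (hsB x hx)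

theorem exists_mem_closure_maps_compl (H : IsCompressing Γ 𝓑) {A B : Set X}
    (hA : A ∈ 𝓑) (hB : B ∈ 𝓑) :
    ∃ d ∈ Subgroup.closure (localCommutators Γ 𝓑), ∀ x ∉ B, d • x ∈ A := by
  obtain ⟨A', hA', B', hB', hAA, hBB, hd⟩ := H.split A hA B hB
  obtain ⟨d₁, hd₁, hm₁⟩ := H.exists_localCommutator_maps_compl hB' hB hBB
  obtain ⟨d₂, hd₂, hm₂⟩ := H.exists_localCommutator_maps_compl hA' hA' subset_rfl
  refine ⟨d₂ * d₁, mul_mem (Subgroup.subset_closure hd₂) (Subgroup.subset_closure hd₁),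
    fun x hx => ?_⟩
  rw [mul_smul]
  exact hAA (hm₂ _ (Set.disjoint_right.1 hd (hm₁ x hx)))

theorem closure_le_commutator : Subgroup.closure (localCommutators Γ 𝓑) ≤ commutator Γ := by
  rw [Subgroup.closure_le]
  rintro _ ⟨-, -, g, h, -, -, rfl⟩
  exact Subgroup.commutator_mem_commutator (Subgroup.mem_top g) (Subgroup.mem_top h)

theorem normal_closure (H : IsCompressing Γ 𝓑) :
    (Subgroup.closure (localCommutators Γ 𝓑)).Normal := by
  have hconj : Group.conjugatesOfSet (localCommutators Γ 𝓑) ⊆ localCommutators Γ 𝓑 := by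
    intro c hc
    obtain ⟨_, ⟨B, hB, g, h, hg, hh, rfl⟩, hc⟩ := Group.mem_conjugatesOfSet_iff.1 hc
    obtain ⟨d, rfl⟩ := isConj_iff.1 hc
    obtain ⟨B', hB', hBB⟩ := H.smul_mem d B hB
    refine ⟨B', hB', d * g * d⁻¹, d * h * d⁻¹, fun x hx => ?_, fun x hx => ?_, ?_⟩
    · rw [mul_smul, mul_smul, hg _ (hBB x hx), smul_inv_smul]
    · rw [mul_smul, mul_smul, hh _ (hBB x hx), smul_inv_smul]
    · simp only [commutatorElement_def]; group
  have : Subgroup.closure (localCommutators Γ 𝓑) =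
      Subgroup.normalClosure (localCommutators Γ 𝓑) :=
    le_antisymm Subgroup.closure_le_normalClosure (Subgroup.closure_mono hconj)
  rw [this]
  infer_instance

theorem commutator_le_closure [FaithfulSMul Γ X] (H : IsCompressing Γ 𝓑) :
    commutator Γ ≤ Subgroup.closure (localCommutators Γ 𝓑) := by
  have hN := H.normal_closure
  set K := Subgroup.closure (localCommutators Γ 𝓑) with hK
  have hfix : ∀ g h : Γ, (∃ B ∈ 𝓑, ∀ x ∈ B, g • x = x) → (∃ B ∈ 𝓑, ∀ x ∈ B, h • x = x) →
      Commute (g : Γ ⧸ K) (h : Γ ⧸ K) := by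
    rintro g h ⟨B, hB, hg⟩ ⟨C, hC, hh⟩
    obtain ⟨d, hd, hm⟩ := H.exists_mem_closure_maps_compl hC hB
    have h1 : Commute (d * g * d⁻¹) h :=
      commute_of_supported (A := C) (B := Cᶜ) disjoint_compl_right
        (smul_conj_eq_of_supported (A := Bᶜ) (fun x hx => hg x (not_not.1 hx)) hm)
        (fun x hx => hh x (not_not.1 hx))
    have h2 := h1.map (QuotientGroup.mk' K)
    have h3 : QuotientGroup.mk' K d = 1 := (QuotientGroup.eq_one_iff d).2 hd
    simpa [map_mul, map_inv, h3] using h2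
  rw [commutator_def, Subgroup.commutator_le]
  rintro g - h -
  obtain ⟨a, b, rfl, ha, hb⟩ := H.factor g
  obtain ⟨a', b', rfl, ha', hb'⟩ := H.factor h
  have : Commute ((a : Γ ⧸ K) * b) ((a' : Γ ⧸ K) * b') :=
    ((hfix a a' ha ha').mul_right (hfix a b' ha hb')).mul_left
      ((hfix b a' hb ha').mul_right (hfix b b' hb hb'))
  rw [← QuotientGroup.eq_one_iff]
  have h2 := commutatorElement_eq_one_iff_commute.2 this
  simpa [commutatorElement_def] using h2

theorem exists_forall_commutator_mem [FaithfulSMul Γ X] (H : IsCompressing Γ 𝓑)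
    {N : Subgroup Γ} (hN : ∀ d ∈ commutator Γ, ∀ n ∈ N, d * n * d⁻¹ ∈ N) {τ : Γ}
    (hτ : τ ∈ N) (hτ1 : τ ≠ 1) :
    ∃ A ∈ 𝓑, ∀ g h : Γ, (∀ x ∉ A, g • x = x) → (∀ x ∉ A, h • x = x) → ⁅g, h⁆ ∈ N := by
  obtain ⟨B, hB, hτB⟩ := H.displace τ hτ1
  obtain ⟨A, hA, A₂, h₂, A₃, h₃, hAB, hA₂, hA₃, h₁₂, h₁₃, h₂₃⟩ := H.exists_three hB
  obtain ⟨s, -, hs, -⟩ := H.swap A₂ h₂ A₂ h₂ subset_rfl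
  obtain ⟨t, -, ht, -⟩ := H.swap A₃ h₃ A₃ h₃ subset_rfl
  refine ⟨A, hA, fun g h hg hh => ?_⟩
  have mono : ∀ {A B : Set X}, A ⊆ B → ∀ {g : Γ}, (∀ x ∉ A, g • x = x) → ∀ x ∉ B, g • x = x :=
    fun hAB _ hg x hx => hg x fun h => hx (hAB h)
  have hg₂ := smul_conj_eq_of_supported (smul_inv_eq_of_supported hg)
    (fun x hx => hs x (Set.disjoint_left.1 h₁₂ hx))
  have hh₃ := smul_conj_eq_of_supported (smul_inv_eq_of_supported hh)
    (fun x hx => ht x (Set.disjoint_left.1 h₁₃ hx))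
  set g₂ := s * g⁻¹ * s⁻¹ with hg₂_def
  set h₃' := t * h⁻¹ * t⁻¹ with hh₃_def
  have hgD : g * g₂ ∈ commutator Γ := by
    have := Subgroup.commutator_mem_commutator (Subgroup.mem_top g) (Subgroup.mem_top s)
    rwa [commutatorElement_def, mul_assoc, mul_assoc, ← mul_assoc s] at this
  have hhD : h * h₃' ∈ commutator Γ := by
    have := Subgroup.commutator_mem_commutator (Subgroup.mem_top h) (Subgroup.mem_top t)
    rwa [commutatorElement_def, mul_assoc, mul_assoc, ← mul_assoc t] at this
  have hgB := smul_mul_eq_of_supported (mono hAB hg) (mono hA₂ hg₂)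
  have hhB := smul_mul_eq_of_supported (mono hAB hh) (mono hA₃ hh₃)
  have hgh : ⁅g * g₂, h * h₃'⁆ = ⁅g, h⁆ := by
    rw [commutatorElement_mul_right_of_commute, commutatorElement_mul_left_of_commute]
    · exact commute_of_supported h₁₂.symm hg₂ hh
    · exact (commute_of_supported h₁₃ hg hh₃).mul_left (commute_of_supported h₂₃ hg₂ hh₃)
  have hk := smul_conj_eq_of_supported (d := τ) (B := (τ⁻¹ • · ) ⁻¹' B)
    (smul_inv_eq_of_supported hgB) (fun x hx => by simpa using hx)
  have hdisj : Disjoint ((τ⁻¹ • · ) ⁻¹' B) B := by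
    rw [Set.disjoint_left]
    intro x hx hxB
    exact hτB _ hx (by simpa using hxB)
  have hn : g * g₂ * (τ * (g * g₂)⁻¹ * τ⁻¹) ∈ N := by
    have := mul_mem (hN _ hgD τ hτ) (inv_mem hτ)
    simpa only [mul_assoc] using this
  rw [← hgh, ← commutatorElement_mul_left_of_commute (commute_of_supported hdisj hk hhB)]
  have := mul_mem hn (hN _ hhD _ (inv_mem hn))
  simpa only [commutatorElement_def, mul_assoc] using this

theorem closure_le_of_conj_mem [FaithfulSMul Γ X] (H : IsCompressing Γ 𝓑)
    {N : Subgroup Γ} (hN : ∀ d ∈ commutator Γ, ∀ n ∈ N, d * n * d⁻¹ ∈ N) (hN1 : N ≠ ⊥) :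
    Subgroup.closure (localCommutators Γ 𝓑) ≤ N := by
  obtain ⟨τ, hτ, hτ1⟩ := N.bot_or_exists_ne_one.resolve_left hN1
  obtain ⟨A, hA, hAN⟩ := H.exists_forall_commutator_mem hN hτ hτ1
  rw [Subgroup.closure_le]
  rintro _ ⟨B, hB, g, h, hg, hh, rfl⟩
  obtain ⟨d, hd, hm⟩ := H.exists_mem_closure_maps_compl hA hB
  have h1 := hAN (d * g * d⁻¹) (d * h * d⁻¹)
    (smul_conj_eq_of_supported (A := Bᶜ) (fun x hx => hg x (not_not.1 hx)) hm)
    (smul_conj_eq_of_supported (A := Bᶜ) (fun x hx => hh x (not_not.1 hx)) hm)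
  have h2 := hN d⁻¹ (inv_mem (closure_le_commutator hd)) _ h1
  have h3 : d⁻¹ * ⁅d * g * d⁻¹, d * h * d⁻¹⁆ * d⁻¹⁻¹ = ⁅g, h⁆ := by
    simp only [commutatorElement_def]; group
  rwa [h3] at h2

theorem nontrivial_commutator (H : IsCompressing Γ 𝓑) : Nontrivial (commutator Γ) := by
  obtain ⟨B, hB⟩ := H.nonempty
  obtain ⟨A, hA, A', hA', -, -, hd⟩ := H.split B hB B hB
  obtain ⟨x, hx⟩ := H.nonempty_of_mem A' hA'
  have hxA := Set.disjoint_right.1 hd hx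
  obtain ⟨d, hd, hm⟩ := H.exists_mem_closure_maps_compl hA hA
  refine (Subgroup.nontrivial_iff_exists_ne_one _).2 ⟨d, closure_le_commutator hd, ?_⟩
  rintro rfl
  exact hxA (by simpa using hm x hxA)

/-- The commutator subgroup of a group acting faithfully with a compressing family is simple. -/
theorem isSimpleGroup_commutator [FaithfulSMul Γ X] (H : IsCompressing Γ 𝓑) :
    IsSimpleGroup (commutator Γ) where
  exists_pair_ne := H.nontrivial_commutator.exists_pair_ne
  eq_bot_or_eq_top_of_normal := by
    intro N hN
    refine or_iff_not_imp_left.2 fun hN1 => ?_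
    have hle := H.commutator_le_closure.trans
      (H.closure_le_of_conj_mem (N := N.map (commutator Γ).subtype) ?_ ?_)
    · rw [eq_top_iff]
      rintro ⟨d, hd⟩ -
      obtain ⟨e, he, hed⟩ := hle hd
      have : e = ⟨d, hd⟩ := Subtype.ext hed
      exact this ▸ he
    · rintro d hd _ ⟨e, he, rfl⟩
      exact ⟨⟨d, hd⟩ * e * ⟨d, hd⟩⁻¹, hN.conj_mem e he _, rfl⟩
    · rwa [Ne, Subgroup.map_eq_bot_iff_of_injective _ (commutator Γ).subtype_injective]

end IsCompressing

end Compressing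

namespace NV

open Set Topology

section Words

variable {k : ℕ}

theorem concat_apply_of_lt {u : List (Fin k)} (x : Cantor k) {i : ℕ} (h : i < u.length) :
    concat u x i = u.get ⟨i, h⟩ := dif_pos h

theorem concat_apply_length_add (u : List (Fin k)) (x : Cantor k) (i : ℕ) :
    concat u x (u.length + i) = x i := by
  simp [concat]

theorem concat_injective (u : List (Fin k)) : Function.Injective (concat u) := by
  intro x y h
  funext i
  rw [← concat_apply_length_add u x i, h, concat_apply_length_add]

theorem concat_append (u v : List (Fin k)) (x : Cantor k) :
    concat (u ++ v) x = concat u (concat v x) := by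
  funext i
  by_cases h : i < u.length
  · rw [concat_apply_of_lt _ h, concat_apply_of_lt _ (by simp; omega)]
    simp [h]
  · obtain ⟨j, rfl⟩ := Nat.exists_eq_add_of_le (not_lt.1 h)
    rw [concat_apply_length_add]
    by_cases h' : j < v.length
    · rw [concat_apply_of_lt _ h', concat_apply_of_lt _ (by simp; omega)]
      simp
    · obtain ⟨l, rfl⟩ := Nat.exists_eq_add_of_le (not_lt.1 h')
      rw [concat_apply_length_add, ← Nat.add_assoc, ← List.length_append,
        concat_apply_length_add]

@[simp] theorem concat_nil (x : Cantor k) : concat [] x = x := by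
  funext i
  simp [concat]

/-- The sequence `x` with its first `L` letters removed. -/
def drop (L : ℕ) (x : Cantor k) : Cantor k := fun i => x (L + i)

theorem concat_drop_eq_iff (u : List (Fin k)) (x : Cantor k) :
    concat u (drop u.length x) = x ↔ ∀ j : Fin u.length, x j = u.get j := by
  refine ⟨fun h j => by rw [← h, concat_apply_of_lt _ j.2], fun h => ?_⟩
  funext i
  by_cases hi : i < u.length
  · rw [concat_apply_of_lt _ hi, h ⟨i, hi⟩]
  · obtain ⟨j, rfl⟩ := Nat.exists_eq_add_of_le (not_lt.1 hi)
    rw [concat_apply_length_add, drop]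

@[simp] theorem drop_concat (u : List (Fin k)) (x : Cantor k) :
    drop u.length (concat u x) = x := by
  funext i
  rw [drop, concat_apply_length_add]

/-- The word formed by the first `L` letters of `x`. -/
def pre (L : ℕ) (x : Cantor k) : List (Fin k) := List.ofFn fun j : Fin L => x j

@[simp] theorem length_pre (L : ℕ) (x : Cantor k) : (pre L x).length = L := by simp [pre]

theorem get_pre (L : ℕ) (x : Cantor k) (j : Fin (pre L x).length) : (pre L x).get j = x j :=
  List.get_ofFn _ j

theorem pre_concat_of_length_le {u : List (Fin k)} {L : ℕ} (h : u.length ≤ L) (x : Cantor k) :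
    pre L (concat u x) = u ++ pre (L - u.length) x := by
  refine List.ext_getElem (by simp; omega) fun i h₁ h₂ => ?_
  by_cases hi : i < u.length
  · simp [pre, hi, concat_apply_of_lt]
  · obtain ⟨j, rfl⟩ := Nat.exists_eq_add_of_le (not_lt.1 hi)
    simp [pre, concat_apply_length_add]

theorem continuous_drop (L : ℕ) : Continuous (drop L : Cantor k → Cantor k) :=
  continuous_pi fun i => continuous_apply (L + i)

theorem continuous_concat (u : List (Fin k)) : Continuous (concat u) := by
  refine continuous_pi fun i => ?_
  by_cases h : i < u.length
  · simp only [concat_apply_of_lt _ h]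
    exact continuous_const
  · simp only [concat, h, dite_false]
    exact continuous_apply _

theorem eq_of_concat_replicate {c d : Fin k} (hcd : c ≠ d) {a b : ℕ}
    {x y : Cantor k}
    (h : concat (List.replicate a c ++ [d]) x = concat (List.replicate b c ++ [d]) y) :
    a = b := by
  have aux : ∀ {a b : ℕ} {x y : Cantor k}, a < b →
      concat (List.replicate a c ++ [d]) x ≠ concat (List.replicate b c ++ [d]) y := by
    intro a b x y hab h
    have h1 := congrFun h a
    rw [concat_apply_of_lt _ (by simp), concat_apply_of_lt _ (by simp; omega)] at h1
    simp [hab] at h1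
    exact hcd h1.symm
  rcases lt_trichotomy a b with hab | hab | hab
  · exact (aux hab h).elim
  · exact hab
  · exact (aux hab h.symm).elim

end Words

section Boxes

variable {n k r : ℕ}

/-- Prefixing the words `u` to all coordinates. -/
def prefixWith (u : Fin n → List (Fin k)) (a : Fin r) (x : Fin n → Cantor k) : Y n k r :=
  (fun i => concat (u i) (x i), a)

/-- Removing the first `L i` letters of the `i`-th coordinate. -/
def tail (L : Fin n → ℕ) (y : Y n k r) : Fin n → Cantor k := fun i => drop (L i) (y.1 i)

theorem mem_box_iff {u : Fin n → List (Fin k)} {a : Fin r} {y : Y n k r} :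
    y ∈ box u a ↔ y.2 = a ∧ ∀ i, ∀ j : Fin (u i).length, y.1 i j = (u i).get j := by
  constructor
  · rintro ⟨x, rfl⟩
    exact ⟨rfl, fun i j => concat_apply_of_lt _ j.2⟩
  · rintro ⟨rfl, h⟩
    exact ⟨fun i => drop (u i).length (y.1 i),
      Prod.ext (funext fun i => ((concat_drop_eq_iff _ _).2 (h i)).symm) rfl⟩

theorem prefixWith_mem_box (u : Fin n → List (Fin k)) (a : Fin r) (x : Fin n → Cantor k) :
    prefixWith u a x ∈ box u a := ⟨x, rfl⟩

theorem prefixWith_injective (u : Fin n → List (Fin k)) (a : Fin r) :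
    Function.Injective (prefixWith u a) := fun _ _ h =>
  funext fun i => concat_injective (u i) (congrFun (congrArg Prod.fst h) i)

theorem prefixWith_append (u w : Fin n → List (Fin k)) (a : Fin r) (x : Fin n → Cantor k) :
    prefixWith (fun i => u i ++ w i) a x =
      prefixWith u a (fun i => concat (w i) (x i)) := by
  simp [prefixWith, concat_append]

theorem isClopen_box (u : Fin n → List (Fin k)) (a : Fin r) : IsClopen (box u a) := by
  have : (box u a : Set (Y n k r)) = Prod.snd ⁻¹' {a} ∩
      ⋂ i, ⋂ j : Fin (u i).length, (fun y : Y n k r => y.1 i j) ⁻¹' {(u i).get j} := by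
    ext y
    simp [mem_box_iff]
  rw [this]
  refine IsClopen.inter ((isClopen_discrete _).preimage continuous_snd)
    (isClopen_iInter_of_finite fun i => isClopen_iInter_of_finite fun j =>
      (isClopen_discrete _).preimage ?_)
  fun_prop

/-- The box of depth `L` containing `y`. -/
def cyl (L : ℕ) (y : Y n k r) : Set (Y n k r) := box (fun i => pre L (y.1 i)) y.2

theorem mem_cyl_iff {L : ℕ} {y z : Y n k r} :
    z ∈ cyl L y ↔ z.2 = y.2 ∧ ∀ i, ∀ j < L, z.1 i j = y.1 i j := by
  rw [cyl, mem_box_iff]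
  refine and_congr_right fun _ => forall_congr' fun i => ?_
  rw [← Fin.forall_iff (p := fun j : Fin L => z.1 i j = y.1 i j)]
  refine (finCongr (length_pre L (y.1 i))).forall_congr fun j => ?_
  rw [get_pre]
  rfl

theorem self_mem_cyl (L : ℕ) (y : Y n k r) : y ∈ cyl L y := by simp [mem_cyl_iff]

theorem cyl_anti {L M : ℕ} (h : L ≤ M) (y : Y n k r) : cyl M y ⊆ cyl L y := fun z hz => by
  rw [mem_cyl_iff] at hz ⊢
  exact ⟨hz.1, fun i j hj => hz.2 i j (hj.trans_le h)⟩

theorem cyl_mem_nhds (L : ℕ) (y : Y n k r) : cyl L y ∈ 𝓝 y :=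
  (isClopen_box _ _).isOpen.mem_nhds (self_mem_cyl L y)

theorem exists_cyl_subset {y : Y n k r} {U : Set (Y n k r)} (hU : U ∈ 𝓝 y) :
    ∃ L, cyl L y ⊆ U := by
  refine exists_subset_nhds_of_compactSpace
    (directed_of_isDirected_le fun L M h => cyl_anti h y)
    (fun L => (isClopen_box _ _).isClosed) fun z hz => ?_
  have : z = y := by
    rw [mem_iInter] at hz
    refine Prod.ext (funext fun i => funext fun j => ?_) (mem_cyl_iff.1 (hz 0)).1
    exact (mem_cyl_iff.1 (hz (j + 1))).2 i j j.lt_succ_self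
  rwa [this]

/-- On the box of depth `L` containing `y`, the map `f` is a prefix substitution. -/
def IsPrefixAt (f : Y n k r → Y n k r) (L : ℕ) (y : Y n k r) : Prop :=
  ∃ (v : Fin n → List (Fin k)) (b : Fin r),
    ∀ x, f (prefixWith (fun i => pre L (y.1 i)) y.2 x) = prefixWith v b x

theorem IsPrefixAt.of_box {f : Y n k r → Y n k r} {u v : Fin n → List (Fin k)} {a b : Fin r}
    (h : ∀ x, f (prefixWith u a x) = prefixWith v b x) {y : Y n k r} (hy : y ∈ box u a) {L : ℕ}
    (hL : ∀ i, (u i).length ≤ L) : IsPrefixAt f L y := by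
  obtain ⟨z, rfl⟩ := hy
  refine ⟨fun i => v i ++ pre (L - (u i).length) (z i), b, fun x => ?_⟩
  simp only [pre_concat_of_length_le (hL _)]
  rw [prefixWith_append, h, prefixWith_append]

theorem IsPrefixAt.mono {f : Y n k r → Y n k r} {L M : ℕ} {y : Y n k r}
    (h : IsPrefixAt f L y) (hLM : L ≤ M) : IsPrefixAt f M y := by
  obtain ⟨v, b, hv⟩ := h
  exact .of_box hv (self_mem_cyl L y) (by simp [hLM])

theorem IsPrefixAt.of_mem_cyl {f : Y n k r → Y n k r} {L : ℕ} {y z : Y n k r}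
    (h : IsPrefixAt f L y) (hz : z ∈ cyl L y) : IsPrefixAt f L z := by
  obtain ⟨v, b, hv⟩ := h
  exact .of_box hv hz (by simp)

/-- The map `f` is a prefix substitution on some box containing `y`. -/
def IsLocalPrefix (f : Y n k r → Y n k r) (y : Y n k r) : Prop := ∃ L, IsPrefixAt f L y

theorem IsLocalPrefix.of_box {f : Y n k r → Y n k r} {u v : Fin n → List (Fin k)} {a b : Fin r}
    (h : ∀ x, f (prefixWith u a x) = prefixWith v b x) {y : Y n k r} (hy : y ∈ box u a) :
    IsLocalPrefix f y :=
  ⟨Finset.univ.sup fun i => (u i).length, IsPrefixAt.of_box h hy fun i =>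
    Finset.le_sup (f := fun i => (u i).length) (Finset.mem_univ i)⟩

theorem IsLocalPrefix.congr {f g : Y n k r → Y n k r} {y : Y n k r} (h : IsLocalPrefix f y)
    {U : Set (Y n k r)} (hU : U ∈ 𝓝 y) (hfg : EqOn g f U) : IsLocalPrefix g y := by
  obtain ⟨L, hL⟩ := h
  obtain ⟨M, hM⟩ := exists_cyl_subset hU
  obtain ⟨v, b, hv⟩ := hL.mono (le_max_left L M)
  refine ⟨max L M, v, b, fun x => ?_⟩
  exact (hfg (hM (cyl_anti (le_max_right L M) y ⟨x, rfl⟩))).trans (hv x)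

theorem IsLocalPrefix.continuousAt {f : Y n k r → Y n k r} {y : Y n k r}
    (h : IsLocalPrefix f y) : ContinuousAt f y := by
  obtain ⟨L, v, b, hv⟩ := h
  have hc : Continuous fun z : Y n k r => prefixWith v b (tail (fun _ => L) z) := by
    refine Continuous.prodMk (continuous_pi fun i => ?_) continuous_const
    exact (continuous_concat _).comp ((continuous_drop L).comp (by fun_prop))
  refine hc.continuousAt.congr (Filter.mem_of_superset (cyl_mem_nhds L y) ?_)
  rintro _ ⟨x, rfl⟩
  have h1 := hv x
  rw [prefixWith] at h1
  simp only [mem_ofPred_eq, h1]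
  congr 1
  funext i
  simp only [tail]
  nth_rewrite 1 [← length_pre L (y.1 i)]
  exact drop_concat _ _

theorem isOpenMap_of_isLocalPrefix {f : Y n k r → Y n k r} (h : ∀ y, IsLocalPrefix f y) :
    IsOpenMap f := by
  intro U hU
  rw [isOpen_iff_mem_nhds]
  rintro _ ⟨y, hy, rfl⟩
  obtain ⟨L, hL⟩ := h y
  obtain ⟨M, hM⟩ := exists_cyl_subset (hU.mem_nhds hy)
  obtain ⟨v, b, hv⟩ := hL.mono (le_max_left L M)
  have himg : f '' cyl (max L M) y = box v b := by
    ext z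
    constructor
    · rintro ⟨_, ⟨x, rfl⟩, rfl⟩
      exact ⟨x, hv x⟩
    · rintro ⟨x, rfl⟩
      exact ⟨_, ⟨x, rfl⟩, hv x⟩
  have hmem : f y ∈ box v b := himg ▸ mem_image_of_mem f (self_mem_cyl _ y)
  refine Filter.mem_of_superset ((isClopen_box v b).isOpen.mem_nhds hmem) ?_
  rw [← himg]
  exact image_mono ((cyl_anti (le_max_right L M) y).trans hM)

theorem exists_forall_isPrefixAt {f : Y n k r → Y n k r} (h : ∀ y, IsLocalPrefix f y) :
    ∃ L, ∀ y, IsPrefixAt f L y := by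
  obtain ⟨L, hL⟩ := isCompact_univ.elim_directed_cover (fun L => {y | IsPrefixAt f L y})
    (fun L => isOpen_iff_mem_nhds.2 fun y hy =>
      Filter.mem_of_superset (cyl_mem_nhds L y) fun z hz => hy.of_mem_cyl hz)
    (fun y _ => mem_iUnion.2 (h y))
    (directed_of_isDirected_le fun L M hLM y hy => hy.mono hLM)
  exact ⟨L, fun y => hL (mem_univ y)⟩

theorem IsElement.isLocalPrefix {γ : Equiv.Perm (Y n k r)} (h : IsElement γ) (y : Y n k r) :
    IsLocalPrefix γ y := by
  obtain ⟨m, u, v, a, b, hu, -, hγ⟩ := h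
  obtain ⟨t, ht, -⟩ := hu y
  exact .of_box (hγ t) ht

theorem isElement_of_isLocalPrefix [NeZero k] {γ : Equiv.Perm (Y n k r)}
    (h : ∀ y, IsLocalPrefix γ y) : IsElement γ := by
  obtain ⟨L, hL⟩ := exists_forall_isPrefixAt h
  let e := (Fintype.equivFin ((Fin n → Fin L → Fin k) × Fin r)).symm
  let p : (Fin n → Fin L → Fin k) × Fin r → Y n k r :=
    fun q => (fun i => concat (List.ofFn (q.1 i)) 0, q.2)
  have hp : ∀ q i, pre L ((p q).1 i) = List.ofFn (q.1 i) := fun q i => by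
    rw [pre_concat_of_length_le (by simp)]
    simp [pre]
  choose v b hv using fun q => hL (p q)
  have hu : ∀ y : Y n k r, ∃! t, y ∈ box (fun i => List.ofFn ((e t).1 i)) (e t).2 := by
    intro y
    refine ⟨e.symm (fun i j => y.1 i j, y.2), ?_, fun t ht => ?_⟩
    · simp only [Equiv.apply_symm_apply]
      exact self_mem_cyl L y
    · obtain ⟨x, rfl⟩ := ht
      rw [Equiv.eq_symm_apply]
      refine Prod.ext (funext fun i => funext fun j => ?_) rfl
      simp [concat_apply_of_lt]
  have hγ : ∀ t x, γ (prefixWith (fun i => List.ofFn ((e t).1 i)) (e t).2 x) =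
      prefixWith (v (e t)) (b (e t)) x := by
    intro t x
    rw [← hv]
    simp only [hp]
    rfl
  have hbox : ∀ y t, y ∈ box (v (e t)) (b (e t)) ↔
      γ.symm y ∈ box (fun i => List.ofFn ((e t).1 i)) (e t).2 := by
    intro y t
    constructor
    · rintro ⟨x, rfl⟩
      refine ⟨x, ?_⟩
      rw [Equiv.symm_apply_eq]
      exact (hγ t x).symm
    · rintro ⟨x, hx⟩
      refine ⟨x, ?_⟩
      rw [Equiv.symm_apply_eq] at hx
      rw [hx]
      exact hγ t x
  refine ⟨_, fun t i => List.ofFn ((e t).1 i), fun t => v (e t), fun t => (e t).2,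
    fun t => b (e t), hu, fun y => ?_, hγ⟩
  simpa only [hbox] using hu (γ.symm y)

end Boxes

section Swap

variable {n k r : ℕ}

/-- An injective map which is locally a prefix substitution and moves the clopen set `S` off itself
can be turned into an involution in the Thompson group exchanging `S` and its image. -/
theorem exists_swap [NeZero k] {f : Y n k r → Y n k r} (hf : Function.Injective f)
    (hloc : ∀ y, IsLocalPrefix f y) {S : Set (Y n k r)} (hS : IsClopen S)
    (hd : ∀ y ∈ S, f y ∉ S) :
    ∃ s : Equiv.Perm (Y n k r), IsElement s ∧ s * s = 1 ∧ (∀ y ∈ S, s y = f y) ∧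
      ∀ y ∉ S, y ∉ f '' S → s y = y := by
  classical
  rcases isEmpty_or_nonempty (Y n k r) with hY | hY
  · exact ⟨1, isElement_of_isLocalPrefix fun y => hY.elim y, rfl, fun y => hY.elim y,
      fun y => hY.elim y⟩
  have hcont : Continuous f := continuous_iff_continuousAt.2 fun y => (hloc y).continuousAt
  have hT : IsClopen (f '' S) :=
    ⟨(hS.isClosed.isCompact.image hcont).isClosed, isOpenMap_of_isLocalPrefix hloc S hS.isOpen⟩
  let g := Function.invFun f
  have hgf : ∀ y, g (f y) = y := Function.leftInverse_invFun hf
  let s : Y n k r → Y n k r := fun y => if y ∈ S then f y else if y ∈ f '' S then g y else y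
  have hs₁ : ∀ y ∈ S, s y = f y := fun y hy => if_pos hy
  have hs₂ : ∀ y ∈ f '' S, s y = g y := by
    rintro _ ⟨y, hy, rfl⟩
    simp only [s, if_neg (hd y hy), if_pos (mem_image_of_mem f hy)]
  have hs₃ : ∀ y ∉ S, y ∉ f '' S → s y = y := fun y h h' => by
    simp only [s, if_neg h, if_neg h']
  have hinv : Function.Involutive s := by
    intro y
    by_cases h₁ : y ∈ S
    · rw [hs₁ y h₁, hs₂ _ (mem_image_of_mem f h₁), hgf]
    by_cases h₂ : y ∈ f '' S
    · obtain ⟨z, hz, rfl⟩ := h₂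
      rw [hs₂ _ (mem_image_of_mem f hz), hgf, hs₁ z hz]
    · rw [hs₃ y h₁ h₂, hs₃ y h₁ h₂]
  refine ⟨hinv.toPerm, isElement_of_isLocalPrefix fun y => ?_, Equiv.ext hinv, hs₁, hs₃⟩
  change IsLocalPrefix s y
  by_cases h₁ : y ∈ S
  · exact (hloc y).congr (hS.isOpen.mem_nhds h₁) hs₁
  by_cases h₂ : y ∈ f '' S
  · refine IsLocalPrefix.congr (f := g) ?_ (hT.isOpen.mem_nhds h₂) hs₂
    obtain ⟨z, -, rfl⟩ := h₂
    obtain ⟨L, v, b, hv⟩ := hloc z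
    obtain ⟨x, hx⟩ := self_mem_cyl L z
    refine .of_box (u := v) (a := b) (v := fun i => pre L (z.1 i)) (b := z.2) (fun x => ?_)
      ⟨x, (congrArg f hx).trans (hv x)⟩
    rw [← hv, hgf]
  · refine IsLocalPrefix.congr (f := id) ?_
      ((hS.compl.inter hT.compl).isOpen.mem_nhds ⟨h₁, h₂⟩) fun z hz => hs₃ z hz.1 hz.2
    exact .of_box (u := fun _ => []) (v := fun _ => []) (fun _ => rfl)
      (mem_box_iff.2 ⟨rfl, fun _ j => j.elim0⟩)

/-- The whole space embeds into any nonempty open set by local prefix substitutions. -/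
theorem exists_embedding (hn : 1 ≤ n) (hk : 2 ≤ k) {U : Set (Y n k r)} (hU : IsOpen U)
    (hne : U.Nonempty) :
    ∃ f : Y n k r → Y n k r, Function.Injective f ∧ (∀ y, IsLocalPrefix f y) ∧ ∀ y, f y ∈ U := by
  obtain ⟨y, hy⟩ := hne
  obtain ⟨L, hL⟩ := exists_cyl_subset (hU.mem_nhds hy)
  let c : Fin k := ⟨0, by omega⟩
  let d : Fin k := ⟨1, by omega⟩
  have hcd : c ≠ d := by simp [c, d]
  let code : Fin r → List (Fin k) := fun a => List.replicate a c ++ [d]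
  let f : Y n k r → Y n k r := fun z =>
    prefixWith (fun i => pre L (y.1 i)) y.2 (fun i => concat (code z.2) (z.1 i))
  refine ⟨f, fun z w h => ?_, fun z => ?_, fun z => hL (prefixWith_mem_box _ _ _)⟩
  · have h1 := prefixWith_injective _ _ h
    have h2 : z.2 = w.2 := Fin.ext (eq_of_concat_replicate hcd (congrFun h1 ⟨0, hn⟩))
    refine Prod.ext (funext fun i => ?_) h2
    have h3 := congrFun h1 i
    simp only [h2] at h3
    exact concat_injective _ h3
  · refine .of_box (u := fun _ => []) (a := z.2)
      (v := fun i => pre L (y.1 i) ++ code z.2) (b := y.2) (fun x => ?_)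
      (mem_box_iff.2 ⟨rfl, fun _ j => j.elim0⟩)
    rw [prefixWith_append]
    simp [f, prefixWith]

theorem exists_ne_of_isOpen (hn : 1 ≤ n) (hk : 2 ≤ k) {U : Set (Y n k r)} (hU : IsOpen U)
    {y : Y n k r} (hy : y ∈ U) : ∃ z ∈ U, z ≠ y := by
  have : Nontrivial (Fin k) := Fin.nontrivial_iff_two_le.2 hk
  obtain ⟨L, hL⟩ := exists_cyl_subset (hU.mem_nhds hy)
  obtain ⟨c, hc⟩ := exists_ne (y.1 ⟨0, hn⟩ L)
  refine ⟨(fun i => Function.update (y.1 i) L c, y.2), hL (mem_cyl_iff.2 ⟨rfl, fun i j hj => ?_⟩),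
    fun h => hc ?_⟩
  · simp [Function.update_of_ne hj.ne]
  · simpa using congrFun (congrFun (congrArg Prod.fst h) ⟨0, hn⟩) L

theorem exists_disjoint_clopen {X : Type*} [TopologicalSpace X] [TotallySeparatedSpace X]
    {A B : Set X} (hA : IsClopen A) (hB : IsClopen B) {a b : X} (ha : a ∈ A) (hb : b ∈ B)
    (hab : a ≠ b) :
    ∃ A' B', (IsClopen A' ∧ a ∈ A') ∧ (IsClopen B' ∧ b ∈ B') ∧ A' ⊆ A ∧ B' ⊆ B ∧
      Disjoint A' B' := by
  obtain ⟨V, hV, haV, hbV⟩ := exists_isClopen_of_totally_separated hab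
  exact ⟨A ∩ V, B ∩ Vᶜ, ⟨hA.inter hV, ha, haV⟩, ⟨hB.inter hV.compl, hb, hbV⟩,
    inter_subset_left, inter_subset_left,
    disjoint_compl_right.mono inter_subset_right inter_subset_right⟩

theorem exists_displaced_clopen {X : Type*} [TopologicalSpace X] [TotallySeparatedSpace X]
    {f : X → X} (hf : Continuous f) {x : X} (hx : f x ≠ x) :
    ∃ B, (IsClopen B ∧ B.Nonempty) ∧ ∀ y ∈ B, f y ∉ B := by
  obtain ⟨V, hV, hfV, hxV⟩ := exists_isClopen_of_totally_separated hx
  exact ⟨f ⁻¹' V ∩ Vᶜ, ⟨(hV.preimage hf).inter hV.compl, x, hfV, hxV⟩,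
    fun y hy h => h.2 hy.1⟩

theorem isCompressing (hn : 1 ≤ n) (hk : 2 ≤ k) (hr : 1 ≤ r)
    {G : Subgroup (Equiv.Perm (Y n k r))}
    (hG : (G : Set (Equiv.Perm (Y n k r))) = thompsonSet n k r) :
    IsCompressing G {B : Set (Y n k r) | IsClopen B ∧ B.Nonempty} := by
  have : NeZero k := ⟨by omega⟩
  have hmem : ∀ γ, γ ∈ G ↔ IsElement γ := fun γ => Set.ext_iff.1 hG γ
  have hloc : ∀ (γ : G) y, IsLocalPrefix (γ : Equiv.Perm (Y n k r)) y := fun γ =>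
    ((hmem _).1 γ.2).isLocalPrefix
  have hcont : ∀ γ : G, Continuous fun y : Y n k r => γ • y := fun γ =>
    continuous_iff_continuousAt.2 fun y => (hloc γ y).continuousAt
  have hsplit : ∀ A : Set (Y n k r), IsClopen A ∧ A.Nonempty → ∀ B : Set (Y n k r),
      IsClopen B ∧ B.Nonempty → ∃ A', (IsClopen A' ∧ A'.Nonempty) ∧ ∃ B',
        (IsClopen B' ∧ B'.Nonempty) ∧ A' ⊆ A ∧ B' ⊆ B ∧ Disjoint A' B' := by
    rintro A ⟨hA, a, ha⟩ B ⟨hB, b', hb'⟩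
    obtain ⟨b, hb, hba⟩ : ∃ b ∈ B, b ≠ a := by
      by_cases h : b' = a
      · exact h ▸ exists_ne_of_isOpen hn hk hB.isOpen hb'
      · exact ⟨b', hb', h⟩
    obtain ⟨A', B', hA', hB', h⟩ := exists_disjoint_clopen hA hB ha hb hba.symm
    exact ⟨A', ⟨hA'.1, a, hA'.2⟩, B', ⟨hB'.1, b, hB'.2⟩, h⟩
  have hdisplace : ∀ g : G, g ≠ 1 → ∃ B : Set (Y n k r), (IsClopen B ∧ B.Nonempty) ∧
      ∀ x ∈ B, g • x ∉ B := by
    intro g hg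
    obtain ⟨x, hx⟩ : ∃ x : Y n k r, g • x ≠ x := by
      by_contra! h
      exact hg (FaithfulSMul.eq_of_smul_eq_smul (α := Y n k r) fun x => by simpa using h x)
    exact exists_displaced_clopen (hcont g) hx
  refine ⟨⟨univ, isClopen_univ, ⟨fun _ => 0, ⟨0, hr⟩⟩, mem_univ _⟩, fun B hB => hB.2, ?_, hsplit,
    ?_, hdisplace, ?_⟩
  · rintro g B ⟨hB, x, hx⟩
    exact ⟨(g⁻¹ • ·) ⁻¹' B, ⟨hB.preimage (hcont _), g • x, by simpa using hx⟩, fun _ h => h⟩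
  · rintro C ⟨hC, -⟩ C' ⟨hC', hne⟩ hCC
    obtain ⟨f, hf, hfloc, hfC⟩ := exists_embedding hn hk hC'.isOpen hne
    obtain ⟨s, hs, hss, hsf, hsi⟩ := exists_swap hf hfloc hC.compl
      fun y _ h => h (hCC (hfC y))
    refine ⟨⟨s, (hmem s).2 hs⟩, Subtype.ext hss, fun x hx => ?_, fun x hx hsx => ?_⟩
    · change s x ∈ C'
      rw [hsf x hx]
      exact hfC x
    · refine hsi x (fun h => h hx) ?_
      rintro ⟨z, hz, rfl⟩
      have h1 : s (f z) = z := by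
        rw [← hsf z hz, ← Equiv.Perm.mul_apply, hss, Equiv.Perm.one_apply]
      change s (f z) ∈ C at hsx
      exact hz (h1 ▸ hsx)
  · intro g
    by_cases hg : g = 1
    · subst hg
      have huniv : IsClopen (univ : Set (Y n k r)) ∧ (univ : Set (Y n k r)).Nonempty :=
        ⟨isClopen_univ, ⟨fun _ => 0, ⟨0, hr⟩⟩, mem_univ _⟩
      exact ⟨1, 1, (one_mul 1).symm, ⟨univ, huniv, fun x _ => one_smul _ x⟩,
        ⟨univ, huniv, fun x _ => one_smul _ x⟩⟩
    obtain ⟨B, hB, hgB⟩ := hdisplace g hg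
    obtain ⟨A, hA, A', hA', hAB, hAB', hd⟩ := hsplit B hB B hB
    obtain ⟨s, hs, hss, hsf, hsi⟩ := exists_swap (g : Equiv.Perm (Y n k r)).injective (hloc g)
      hA.1 fun y hy h => hgB y (hAB hy) (hAB h)
    have hsinv : s⁻¹ = s := inv_eq_of_mul_eq_one_left hss
    let s' : G := ⟨s, (hmem s).2 hs⟩
    refine ⟨s', s'⁻¹ * g, (mul_inv_cancel_left _ _).symm, ⟨A', hA', fun x hx => ?_⟩,
      ⟨A, hA, fun x hx => ?_⟩⟩
    · refine hsi x (Set.disjoint_right.1 hd hx) ?_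
      rintro ⟨z, hz, rfl⟩
      exact hgB z (hAB hz) (hAB' hx)
    · rw [mul_smul, inv_smul_eq_iff]
      exact (hsf x hx).symm

end Swap

end NV

theorem statement5 (n k r : ℕ) (hn : 1 ≤ n) (hk : 2 ≤ k) (hr : 1 ≤ r)
    (G : Subgroup (Equiv.Perm (NV.Y n k r)))
    (hG : (G : Set (Equiv.Perm (NV.Y n k r))) = NV.thompsonSet n k r) :
    IsSimpleGroup ↥(commutator ↥G) := by
  exact (NV.isCompressing hn hk hr hG).isSimpleGroup_commutator
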